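/- Triangle bound for diagrams of 3-connected graphs (Proposition 4.17). Fix a dimension d > 6 and constants 0 < c ≤ C₀, and let τ: ℤ^d → [0,1] satisfy τ(0) = 1, τ(−x) = τ(x), and c(1+|x|)^{2−d} ≤ τ(x) ≤ C₀(1+|x|)^{2−d} for all x ∈ ℤ^d ∖ {0}; write τ(x,y) := τ(y−x). Let G be a finite connected simple graph with three distinct vertices x, y, z ∈ V(G) such that G is 3-connected to {x,y,z}, every vertex in V(G) ∖ {x,y,z} has degree 3, and x, y, z each have degree exactly 2. Let u, u' ∈ ℤ^d and let ℓ assign the labels ℓ(x) = 0, ℓ(y) = u, ℓ(z) = u'. Then Diag(G,{x,y,z},ℓ) ≤ C_{|E(G)|} · τ(0,u) τ(u,u') τ(u',0), where the constant C_{|E(G)|} < ∞ depends only on the number of edges of G (and on d, c, C₀). -/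

import Mathlib

open scoped Classical

/-- A finite multigraph on a vertex type `V`: a finite vertex set together with
an edge-multiplicity function on unordered pairs, supported on pairs of vertices. -/
structure Multigraph (V : Type) where
  verts : Finset V
  mult : Sym2 V → ℕ
  supp : ∀ e : Sym2 V, mult e ≠ 0 → ∀ v ∈ e, v ∈ verts

namespace Multigraph

variable {V : Type}

/-- The multiset of neighbours of `x`, counted with edge multiplicity. -/
def nbrs (G : Multigraph V) (x : V) : Multiset V :=
  G.verts.val.bind fun u => Multiset.replicate (G.mult s(x, u)) u

/-- The (edge-)degree of a vertex: the number of edges incident to it. -/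
def deg (G : Multigraph V) (x : V) : ℕ := (G.nbrs x).card

/-- Adjacency: `a ≠ b` and at least one edge joins `a` and `b`. -/
def Adj (G : Multigraph V) (a b : V) : Prop := a ≠ b ∧ G.mult s(a, b) ≠ 0

/-- A multigraph is simple if all multiplicities are at most one and there
are no self-loops. -/
def IsSimple (G : Multigraph V) : Prop :=
  (∀ e : Sym2 V, G.mult e ≤ 1) ∧ ∀ v : V, G.mult s(v, v) = 0

/-- Connectivity of a multigraph. -/
def Connected (G : Multigraph V) : Prop :=
  G.verts.Nonempty ∧ ∀ u ∈ G.verts, ∀ v ∈ G.verts, Relation.ReflTransGen G.Adj u v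

/-- The number of edges (counted with multiplicity). -/
def numEdges (G : Multigraph V) : ℕ := ∑ e ∈ G.verts.sym2, G.mult e

end Multigraph

/-- The list of (unordered) edges traversed by a list of vertices. -/
def listEdges {V : Type} (l : List V) : List (Sym2 V) :=
  (l.zip l.tail).map fun p => s(p.1, p.2)

namespace Multigraph

variable {V : Type}

/-- `l` is a (simple) path in `G`: a nonempty list of distinct vertices of `G`
in which consecutive vertices are adjacent. -/
def IsPathList (G : Multigraph V) (l : List V) : Prop :=
  l ≠ [] ∧ l.Nodup ∧ (∀ v ∈ l, v ∈ G.verts) ∧ l.Chain' G.Adj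

/-- `l` is a simple path in `G` from `a` to `b`. -/
def IsPathBetween (G : Multigraph V) (a b : V) (l : List V) : Prop :=
  G.IsPathList l ∧ l.head? = some a ∧ l.getLast? = some b

/-- `x` is 3-connected to `{s₁, s₂, s₃}`: there are three pairwise edge-disjoint
paths from `x` to `s₁`, `s₂` and `s₃` respectively. -/
def ThreeConnFrom (G : Multigraph V) (s₁ s₂ s₃ x : V) : Prop :=
  ∃ l₁ l₂ l₃ : List V,
    G.IsPathBetween x s₁ l₁ ∧ G.IsPathBetween x s₂ l₂ ∧ G.IsPathBetween x s₃ l₃ ∧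
    (listEdges l₁).Disjoint (listEdges l₂) ∧
    (listEdges l₁).Disjoint (listEdges l₃) ∧
    (listEdges l₂).Disjoint (listEdges l₃)

/-- `G` is 3-connected to `{s₁, s₂, s₃}`: every vertex outside `{s₁, s₂, s₃}`
is 3-connected to `{s₁, s₂, s₃}`. -/
def ThreeConnTo (G : Multigraph V) (s₁ s₂ s₃ : V) : Prop :=
  ∀ x ∈ G.verts, x ≠ s₁ → x ≠ s₂ → x ≠ s₃ → G.ThreeConnFrom s₁ s₂ s₃ x

/-- The edge `{x, y}` is H-reducible: `x` and `y` both have degree at least 3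
and are joined by exactly one edge. -/
def HReducible (G : Multigraph V) (x y : V) : Prop :=
  x ∈ G.verts ∧ y ∈ G.verts ∧ x ≠ y ∧ G.mult s(x, y) = 1 ∧
    3 ≤ G.deg x ∧ 3 ≤ G.deg y

/-- `G'` is the H-reduction of `G` by the H-reducible edge `{x, y}`:
if `x` (resp. `y`) has degree `3` it is deleted and its two remaining
neighbours get joined by a new edge `e_{x∖y}` (resp. `e_{y∖x}`); a vertex of
degree at least `4` is kept; if both have degree at least `4`, only the edge
`{x, y}` is deleted. -/
def IsHReductionBy (G : Multigraph V) (x y : V) (G' : Multigraph V) : Prop :=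
  G.HReducible x y ∧
    ((G.deg x = 3 ∧ G.deg y = 3 ∧
        ∃ z₁ z₂ t₁ t₂ : V,
          G.nbrs x = {y, z₁, z₂} ∧ G.nbrs y = {x, t₁, t₂} ∧
          (∀ v : V, v ∈ G'.verts ↔ v ∈ G.verts ∧ v ≠ x ∧ v ≠ y) ∧
          ∀ e : Sym2 V, G'.mult e =
            (if x ∈ e ∨ y ∈ e then 0 else G.mult e)
              + (if e = s(z₁, z₂) then 1 else 0)
              + (if e = s(t₁, t₂) then 1 else 0)) ∨
     (G.deg x = 3 ∧ 4 ≤ G.deg y ∧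
        ∃ z₁ z₂ : V, G.nbrs x = {y, z₁, z₂} ∧
          (∀ v : V, v ∈ G'.verts ↔ v ∈ G.verts ∧ v ≠ x) ∧
          ∀ e : Sym2 V, G'.mult e =
            (if x ∈ e then 0 else G.mult e) + (if e = s(z₁, z₂) then 1 else 0)) ∨
     (G.deg y = 3 ∧ 4 ≤ G.deg x ∧
        ∃ t₁ t₂ : V, G.nbrs y = {x, t₁, t₂} ∧
          (∀ v : V, v ∈ G'.verts ↔ v ∈ G.verts ∧ v ≠ y) ∧
          ∀ e : Sym2 V, G'.mult e =
            (if y ∈ e then 0 else G.mult e) + (if e = s(t₁, t₂) then 1 else 0)) ∨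
     (4 ≤ G.deg x ∧ 4 ≤ G.deg y ∧
        (∀ v : V, v ∈ G'.verts ↔ v ∈ G.verts) ∧
        ∀ e : Sym2 V, G'.mult e = if e = s(x, y) then 0 else G.mult e))

end Multigraph

open scoped ENNReal

/-- The vertex set of the hypercubic lattice `ℤ^d`. -/
abbrev Vtx (d : ℕ) := Fin d → ℤ

/-- The Euclidean norm of a point of `ℤ^d`. -/
noncomputable def znorm {d : ℕ} (x : Vtx d) : ℝ :=
  Real.sqrt (∑ i, ((x i : ℝ)) ^ 2)

/-- The symmetrised two-point function on unordered pairs; for a symmetric `τ`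
this is exactly `τ(x, y) = τ(y − x)`. -/
noncomputable def tauSym {d : ℕ} (τ : Vtx d → ℝ) : Sym2 (Vtx d) → ℝ :=
  Sym2.lift ⟨fun a b => (τ (b - a) + τ (a - b)) / 2, fun a b => by ring⟩

/-- The diagram of a diagrammatic graph `(G, S, ℓ)`: the sum over all labellings
`f` extending `ℓ` of the product of the two-point functions along the edges of
`G`, counted with multiplicity. -/
noncomputable def Multigraph.Diag {V : Type} {d : ℕ} (τ : Vtx d → ℝ)
    (G : Multigraph V) (S : Set V) (ℓ : V → Vtx d) : ℝ≥0∞ :=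
  ∑' f : {f : V → Vtx d // (∀ v ∈ S, f v = ℓ v) ∧ ∀ v, v ∉ G.verts → f v = 0},
    ∏ e ∈ G.verts.sym2, ENNReal.ofReal (tauSym τ (Sym2.map f.1 e)) ^ G.mult e

section PairKernel

/-- A symmetric kernel that behaves like the square root of a two-point function: `r` is
uniformly cube-summable, and of two values `r a p`, `r b p` the smaller one is controlled by
`r a b`. -/
structure PairKernel {α : Type*} (r : α → α → ℝ≥0∞) (K T : ℝ≥0∞) : Prop where
  symm : ∀ a b, r a b = r b a
  mul_le : ∀ a b p, r a p * r b p ≤ K * r a b * (r a p + r b p)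
  tsum_cube_le : ∀ a, ∑' p, r a p ^ 3 ≤ T

theorem ENNReal.mul_mul_le_cubes (a b c : ℝ≥0∞) : a * b * c ≤ a ^ 3 + b ^ 3 + c ^ 3 := by
  have key : ∀ m : ℝ≥0∞, a ≤ m → b ≤ m → c ≤ m → a * b * c ≤ m ^ 3 := fun m ha hb hc => by
    calc a * b * c ≤ m * m * m := by gcongr
      _ = m ^ 3 := by ring
  rcases le_total a b with hab | hab
  · rcases le_total b c with hbc | hbc
    · exact (key c (hab.trans hbc) hbc le_rfl).trans le_add_self
    · exact (key b hab le_rfl hbc).trans (le_add_self.trans le_self_add)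
  · rcases le_total a c with hac | hac
    · exact (key c hac (hab.trans hac) le_rfl).trans le_add_self
    · exact (key a le_rfl hab hac).trans (le_self_add.trans le_self_add)

theorem ENNReal.add_cube_le (a b : ℝ≥0∞) : (a + b) ^ 3 ≤ 8 * (a ^ 3 + b ^ 3) := by
  rcases le_total a b with h | h
  · calc (a + b) ^ 3 ≤ (b + b) ^ 3 := by gcongr
      _ = 8 * b ^ 3 := by ring
      _ ≤ _ := by gcongr; exact le_add_self
  · calc (a + b) ^ 3 ≤ (a + a) ^ 3 := by gcongr
      _ = 8 * a ^ 3 := by ring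
      _ ≤ _ := by gcongr; exact le_self_add

namespace PairKernel

variable {α : Type*} {r : α → α → ℝ≥0∞} {K T : ℝ≥0∞}

theorem tsum_add_cube_le (h : PairKernel r K T) (a b : α) :
    ∑' p, (r a p + r b p) ^ 3 ≤ 16 * T := by
  calc ∑' p, (r a p + r b p) ^ 3 ≤ ∑' p, 8 * (r a p ^ 3 + r b p ^ 3) :=
        ENNReal.tsum_le_tsum fun p => ENNReal.add_cube_le _ _
    _ = 8 * (∑' p, r a p ^ 3 + ∑' p, r b p ^ 3) := by rw [ENNReal.tsum_mul_left, ENNReal.tsum_add]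
    _ ≤ 8 * (T + T) := by gcongr <;> exact h.tsum_cube_le _
    _ = 16 * T := by ring

/-- An `H`-shaped subdiagram is bounded by the two edges that replace it. -/
theorem tsum_H_le (h : PairKernel r K T) (z₁ z₂ t₁ t₂ : α) :
    ∑' a, ∑' b, r a b ^ 2 * (r a z₁ ^ 2 * r a z₂ ^ 2) * (r b t₁ ^ 2 * r b t₂ ^ 2)
      ≤ (K ^ 4 * (288 * T ^ 2)) * (r z₁ z₂ ^ 2 * r t₁ t₂ ^ 2) := by
  have pt : ∀ a b, r a b ^ 2 * (r a z₁ ^ 2 * r a z₂ ^ 2) * (r b t₁ ^ 2 * r b t₂ ^ 2) ≤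
      (K ^ 4 * (r z₁ z₂ ^ 2 * r t₁ t₂ ^ 2)) *
        ((r z₁ a + r z₂ a) ^ 3 * r a b ^ 3 + r b a ^ 3 * (r t₁ b + r t₂ b) ^ 3
          + (r z₁ a + r z₂ a) ^ 3 * (r t₁ b + r t₂ b) ^ 3) := by
    intro a b
    have h1 := h.mul_le z₁ z₂ a
    have h2 := h.mul_le t₁ t₂ b
    calc r a b ^ 2 * (r a z₁ ^ 2 * r a z₂ ^ 2) * (r b t₁ ^ 2 * r b t₂ ^ 2)
        = r a b ^ 2 * (r z₁ a * r z₂ a) ^ 2 * (r t₁ b * r t₂ b) ^ 2 := by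
          rw [h.symm a z₁, h.symm a z₂, h.symm b t₁, h.symm b t₂]; ring
      _ ≤ r a b ^ 2 * (K * r z₁ z₂ * (r z₁ a + r z₂ a)) ^ 2 *
            (K * r t₁ t₂ * (r t₁ b + r t₂ b)) ^ 2 := by gcongr
      _ = (K ^ 4 * (r z₁ z₂ ^ 2 * r t₁ t₂ ^ 2)) *
          (((r z₁ a + r z₂ a) * r a b) * (r a b * (r t₁ b + r t₂ b)) *
            ((r z₁ a + r z₂ a) * (r t₁ b + r t₂ b))) := by ring
      _ ≤ _ := by
        gcongr
        refine (ENNReal.mul_mul_le_cubes _ _ _).trans (le_of_eq ?_)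
        rw [h.symm b a]; ring
  have hP := h.tsum_add_cube_le z₁ z₂
  have hR := h.tsum_add_cube_le t₁ t₂
  have e1 : ∑' a, ∑' b, (r z₁ a + r z₂ a) ^ 3 * r a b ^ 3 ≤ 16 * T * T := by
    simp_rw [ENNReal.tsum_mul_left]
    calc _ ≤ ∑' a, (r z₁ a + r z₂ a) ^ 3 * T := ENNReal.tsum_le_tsum fun a => by
            gcongr; exact h.tsum_cube_le a
      _ ≤ _ := by rw [ENNReal.tsum_mul_right]; gcongr
  have e2 : ∑' a, ∑' b, r b a ^ 3 * (r t₁ b + r t₂ b) ^ 3 ≤ T * (16 * T) := by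
    rw [ENNReal.tsum_comm]
    simp_rw [ENNReal.tsum_mul_right]
    calc _ ≤ ∑' b, T * (r t₁ b + r t₂ b) ^ 3 := ENNReal.tsum_le_tsum fun b => by
            gcongr; exact h.tsum_cube_le b
      _ ≤ _ := by rw [ENNReal.tsum_mul_left]; gcongr
  have e3 : ∑' a, ∑' b, (r z₁ a + r z₂ a) ^ 3 * (r t₁ b + r t₂ b) ^ 3 ≤ 16 * T * (16 * T) := by
    simp_rw [ENNReal.tsum_mul_left, ENNReal.tsum_mul_right]
    gcongr
  calc _ ≤ ∑' a, ∑' b, _ := ENNReal.tsum_le_tsum fun a => ENNReal.tsum_le_tsum fun b => pt a b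
    _ = (K ^ 4 * (r z₁ z₂ ^ 2 * r t₁ t₂ ^ 2)) *
        (∑' a, ∑' b, (r z₁ a + r z₂ a) ^ 3 * r a b ^ 3
          + ∑' a, ∑' b, r b a ^ 3 * (r t₁ b + r t₂ b) ^ 3
          + ∑' a, ∑' b, (r z₁ a + r z₂ a) ^ 3 * (r t₁ b + r t₂ b) ^ 3) := by
      simp_rw [ENNReal.tsum_mul_left, ENNReal.tsum_add, ENNReal.tsum_mul_left]
    _ ≤ (K ^ 4 * (r z₁ z₂ ^ 2 * r t₁ t₂ ^ 2)) *
        (16 * T * T + T * (16 * T) + 16 * T * (16 * T)) := by gcongr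
    _ = _ := by ring

/-- A star diagram is bounded by the square root of the triangle. -/
theorem tsum_star_le (h : PairKernel r K T) (x y z : α) :
    ∑' p, r p x ^ 2 * r p y ^ 2 * r p z ^ 2
      ≤ K ^ 3 * (48 * T) * (r x y * r x z * r y z) := by
  have pt : ∀ p, r p x ^ 2 * r p y ^ 2 * r p z ^ 2 ≤ K ^ 3 * (r x y * r x z * r y z) *
      ((r x p + r y p) ^ 3 + (r x p + r z p) ^ 3 + (r y p + r z p) ^ 3) := by
    intro p
    calc r p x ^ 2 * r p y ^ 2 * r p z ^ 2
        = (r x p * r y p) * (r x p * r z p) * (r y p * r z p) := by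
          rw [h.symm p x, h.symm p y, h.symm p z]; ring
      _ ≤ (K * r x y * (r x p + r y p)) * (K * r x z * (r x p + r z p)) *
            (K * r y z * (r y p + r z p)) := by
          exact mul_le_mul' (mul_le_mul' (h.mul_le _ _ _) (h.mul_le _ _ _)) (h.mul_le _ _ _)
      _ = K ^ 3 * (r x y * r x z * r y z) *
            ((r x p + r y p) * (r x p + r z p) * (r y p + r z p)) := by ring
      _ ≤ _ := by gcongr; exact ENNReal.mul_mul_le_cubes _ _ _
  calc _ ≤ ∑' p, _ := ENNReal.tsum_le_tsum pt
    _ = K ^ 3 * (r x y * r x z * r y z) * (∑' p, (r x p + r y p) ^ 3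
          + ∑' p, (r x p + r z p) ^ 3 + ∑' p, (r y p + r z p) ^ 3) := by
        simp_rw [ENNReal.tsum_mul_left, ENNReal.tsum_add]
    _ ≤ K ^ 3 * (r x y * r x z * r y z) * (16 * T + 16 * T + 16 * T) := by
        gcongr <;> exact h.tsum_add_cube_le _ _
    _ = _ := by ring

end PairKernel

end PairKernel

section LatticeDecay

theorem znorm_eq_norm {d : ℕ} (x : Vtx d) :
    znorm x = ‖WithLp.toLp 2 (fun i => (x i : ℝ))‖ := by
  simp [znorm, EuclideanSpace.norm_eq]

theorem znorm_nonneg {d : ℕ} (x : Vtx d) : 0 ≤ znorm x := Real.sqrt_nonneg _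

theorem znorm_neg {d : ℕ} (x : Vtx d) : znorm (-x) = znorm x := by simp [znorm]

theorem znorm_zero {d : ℕ} : znorm (0 : Vtx d) = 0 := by simp [znorm]

theorem znorm_add_le {d : ℕ} (x y : Vtx d) : znorm (x + y) ≤ znorm x + znorm y := by
  simp only [znorm_eq_norm]
  have h := norm_add_le (WithLp.toLp 2 (fun i => (x i : ℝ))) (WithLp.toLp 2 (fun i => (y i : ℝ)))
  rw [← WithLp.toLp_add] at h
  simpa [Pi.add_def] using h

theorem abs_coord_le_znorm {d : ℕ} (x : Vtx d) (i : Fin d) : |(x i : ℝ)| ≤ znorm x := by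
  rw [znorm, ← Real.sqrt_sq_eq_abs]
  exact Real.sqrt_le_sqrt
    (Finset.single_le_sum (f := fun i => (x i : ℝ) ^ 2) (fun j _ => sq_nonneg _)
      (Finset.mem_univ i))

theorem ENNReal.tsum_fin_pi_prod {β : Type*} (g : β → ℝ≥0∞) (d : ℕ) :
    ∑' w : Fin d → β, ∏ i, g (w i) = (∑' b, g b) ^ d := by
  induction d with
  | zero => simp
  | succ d ih =>
    rw [← (Fin.consEquiv fun _ : Fin (d + 1) => β).tsum_eq, ENNReal.tsum_prod']
    simp [Fin.consEquiv, Fin.prod_univ_succ, ENNReal.tsum_mul_left, ENNReal.tsum_mul_right, ih,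
      pow_succ']

/-- The square root of the decay rate `(1 + |w|) ^ (2 - d)`. -/
noncomputable def sqrtDecay (d : ℕ) (w : Vtx d) : ℝ := (1 + znorm w) ^ ((2 - (d : ℝ)) / 2)

theorem sqrtDecay_nonneg {d : ℕ} (w : Vtx d) : 0 ≤ sqrtDecay d w :=
  Real.rpow_nonneg (by linarith [znorm_nonneg w]) _

theorem sqrtDecay_sq {d : ℕ} (w : Vtx d) :
    sqrtDecay d w ^ 2 = (1 + znorm w) ^ (2 - (d : ℝ)) := by
  rw [sqrtDecay, ← Real.rpow_natCast, ← Real.rpow_mul (by linarith [znorm_nonneg w])]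
  norm_num

theorem sqrtDecay_mul_le {d : ℕ} (hd : 2 ≤ d) (v w : Vtx d) :
    sqrtDecay d v * sqrtDecay d w ≤
      2 ^ (((d : ℝ) - 2) / 2) * sqrtDecay d (v + w) * (sqrtDecay d v + sqrtDecay d w) := by
  have hd' : (2 : ℝ) ≤ d := by exact_mod_cast hd
  have key : ∀ a : Vtx d, znorm (v + w) ≤ 2 * znorm a →
      sqrtDecay d a ≤ 2 ^ (((d : ℝ) - 2) / 2) * sqrtDecay d (v + w) := by
    intro a ha
    have h0 := znorm_nonneg (v + w)
    have : sqrtDecay d a ≤ (2⁻¹ * (1 + znorm (v + w))) ^ ((2 - (d : ℝ)) / 2) :=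
      Real.rpow_le_rpow_of_nonpos (by positivity) (by linarith) (by linarith)
    refine this.trans (le_of_eq ?_)
    rw [Real.mul_rpow (by norm_num) (by linarith), Real.inv_rpow (by norm_num),
      ← Real.rpow_neg (by norm_num), sqrtDecay]
    congr 2; ring
  have h0 := znorm_add_le v w
  have hv := sqrtDecay_nonneg v
  have hw := sqrtDecay_nonneg w
  rcases le_total (znorm v) (znorm w) with h | h
  · have := mul_le_mul_of_nonneg_left (key w (by linarith)) hv
    have h3 := mul_nonneg ((sqrtDecay_nonneg w).trans (key w (by linarith))) hw
    linarith
  · have := mul_le_mul_of_nonneg_left (key v (by linarith)) hw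
    have h3 := mul_nonneg ((sqrtDecay_nonneg v).trans (key v (by linarith))) hv
    linarith

theorem tsum_sqrtDecay_cube_ne_top {d : ℕ} (hd : 6 < d) :
    ∑' w : Vtx d, ENNReal.ofReal (sqrtDecay d w) ^ 3 ≠ ⊤ := by
  have hd' : (6 : ℝ) < d := by exact_mod_cast hd
  have hd0 : (0 : ℝ) < d := by linarith
  set q : ℝ := 3 * ((d : ℝ) - 2) / 2 / d with hq
  have hq1 : 1 < q := by rw [hq, lt_div_iff₀ hd0]; linarith
  have hsum : ∑' n : ℤ, ENNReal.ofReal ((1 + |(n : ℝ)|) ^ (-q)) ≠ ⊤ := by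
    have hs : Summable fun n : ℤ => (1 + |(n : ℝ)|) ^ (-q) := by
      have h1 := Real.summable_abs_int_rpow hq1
      refine Summable.of_norm_bounded_eventually h1 ?_
      have : ({0} : Set ℤ).Finite := Set.finite_singleton 0
      filter_upwards [this.compl_mem_cofinite] with n hn
      have hn0 : (0 : ℝ) < |(n : ℝ)| := by
        rw [abs_pos]; exact_mod_cast hn
      rw [Real.norm_of_nonneg (by positivity)]
      exact Real.rpow_le_rpow_of_nonpos hn0 (by linarith) (by linarith)
    rw [← ENNReal.ofReal_tsum_of_nonneg (fun n => by positivity) hs]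
    exact ENNReal.ofReal_ne_top
  refine ne_top_of_le_ne_top (ENNReal.pow_ne_top (n := d) hsum) ?_
  rw [← ENNReal.tsum_fin_pi_prod]
  refine ENNReal.tsum_le_tsum fun w => ?_
  rw [← ENNReal.ofReal_pow (sqrtDecay_nonneg w),
    ← ENNReal.ofReal_prod_of_nonneg (fun i _ => by positivity)]
  refine ENNReal.ofReal_le_ofReal ?_
  have h0 : 0 < 1 + znorm w := by linarith [znorm_nonneg w]
  calc sqrtDecay d w ^ 3 = ∏ _i : Fin d, (1 + znorm w) ^ (-q) := by
        rw [Finset.prod_const, Finset.card_univ, Fintype.card_fin, sqrtDecay,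
          ← Real.rpow_natCast, ← Real.rpow_natCast, ← Real.rpow_mul h0.le, ← Real.rpow_mul h0.le]
        congr 1
        rw [hq]; field_simp; push_cast; ring
    _ ≤ _ := Finset.prod_le_prod (fun i _ => by positivity) fun i _ =>
        Real.rpow_le_rpow_of_nonpos (by positivity) (by linarith [abs_coord_le_znorm w i])
          (by linarith)

/-- The pair version of `sqrtDecay`, with values in `ℝ≥0∞`. -/
noncomputable def pairDecay (d : ℕ) (a b : Vtx d) : ℝ≥0∞ := ENNReal.ofReal (sqrtDecay d (b - a))

theorem pairKernel_pairDecay {d : ℕ} (hd : 6 < d) :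
    PairKernel (pairDecay d) (ENNReal.ofReal (2 ^ (((d : ℝ) - 2) / 2)))
      (∑' w : Vtx d, ENNReal.ofReal (sqrtDecay d w) ^ 3) where
  symm a b := by
    rw [pairDecay, pairDecay, ← neg_sub a b, sqrtDecay, sqrtDecay, znorm_neg]
  mul_le a b p := by
    have h1 : sqrtDecay d (b - p) = sqrtDecay d (p - b) := by
      rw [← neg_sub p b, sqrtDecay, sqrtDecay, znorm_neg]
    have h2 : sqrtDecay d (p - a + (b - p)) = sqrtDecay d (b - a) := by congr 1; abel
    have h := sqrtDecay_mul_le (d := d) (by omega) (p - a) (b - p)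
    rw [h1, h2] at h
    simp only [pairDecay]
    rw [← ENNReal.ofReal_add (sqrtDecay_nonneg _) (sqrtDecay_nonneg _),
      ← ENNReal.ofReal_mul (sqrtDecay_nonneg _), ← ENNReal.ofReal_mul (by positivity),
      ← ENNReal.ofReal_mul (mul_nonneg (by positivity) (sqrtDecay_nonneg _))]
    exact ENNReal.ofReal_le_ofReal h
  tsum_cube_le a := by
    refine le_of_eq ?_
    exact (Equiv.subRight a).tsum_eq fun w => ENNReal.ofReal (sqrtDecay d w) ^ 3

end LatticeDecay

section EdgeCounts

variable {V : Type*}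

/-- `1` if the edge has exactly one end in `A`, and `0` otherwise. -/
noncomputable def cutInd (A : Finset V) : Sym2 V → ℕ :=
  Sym2.lift ⟨fun a b => if a ∈ A ↔ b ∈ A then 0 else 1, fun a b => by simp only [iff_comm]⟩

/-- `1` if both ends of the edge are in `A`, and `0` otherwise. -/
noncomputable def insideInd (A : Finset V) : Sym2 V → ℕ :=
  Sym2.lift ⟨fun a b => if a ∈ A ∧ b ∈ A then 1 else 0, fun a b => by simp only [and_comm]⟩

/-- The number of ends of the edge that are equal to `v`. -/
noncomputable def incInd (v : V) : Sym2 V → ℕ :=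
  Sym2.lift ⟨fun a b => (if a = v then 1 else 0) + (if b = v then 1 else 0),
    fun _ _ => add_comm _ _⟩

@[simp] theorem cutInd_mk (A : Finset V) (a b : V) :
    cutInd A s(a, b) = if a ∈ A ↔ b ∈ A then 0 else 1 := rfl

@[simp] theorem insideInd_mk (A : Finset V) (a b : V) :
    insideInd A s(a, b) = if a ∈ A ∧ b ∈ A then 1 else 0 := rfl

@[simp] theorem incInd_mk (v a b : V) :
    incInd v s(a, b) = (if a = v then 1 else 0) + (if b = v then 1 else 0) := rfl

/-- The number of edges of `M` leaving `A`. -/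
noncomputable def cutCount (M : Multiset (Sym2 V)) (A : Finset V) : ℕ := (M.map (cutInd A)).sum

/-- The number of edges of `M` with both ends in `A`. -/
noncomputable def insideCount (M : Multiset (Sym2 V)) (A : Finset V) : ℕ :=
  (M.map (insideInd A)).sum

/-- The degree of `v` in `M`, a loop counting twice. -/
noncomputable def edgeDeg (M : Multiset (Sym2 V)) (v : V) : ℕ := (M.map (incInd v)).sum

@[simp] theorem cutCount_cons (e : Sym2 V) (M : Multiset (Sym2 V)) (A : Finset V) :
    cutCount (e ::ₘ M) A = cutInd A e + cutCount M A := by simp [cutCount]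

@[simp] theorem insideCount_cons (e : Sym2 V) (M : Multiset (Sym2 V)) (A : Finset V) :
    insideCount (e ::ₘ M) A = insideInd A e + insideCount M A := by simp [insideCount]

@[simp] theorem edgeDeg_cons (e : Sym2 V) (M : Multiset (Sym2 V)) (v : V) :
    edgeDeg (e ::ₘ M) v = incInd v e + edgeDeg M v := by simp [edgeDeg]

theorem sum_incInd (A : Finset V) (e : Sym2 V) :
    ∑ v ∈ A, incInd v e = 2 * insideInd A e + cutInd A e := by
  induction e using Sym2.ind with
  | _ a b =>
    simp only [incInd_mk, insideInd_mk, cutInd_mk, Finset.sum_add_distrib, Finset.sum_ite_eq]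
    by_cases ha : a ∈ A <;> by_cases hb : b ∈ A <;> simp [ha, hb]

theorem sum_edgeDeg (M : Multiset (Sym2 V)) (A : Finset V) :
    ∑ v ∈ A, edgeDeg M v = 2 * insideCount M A + cutCount M A := by
  induction M using Multiset.induction_on with
  | empty => simp [edgeDeg, insideCount, cutCount]
  | cons e M ih =>
    simp only [edgeDeg_cons, insideCount_cons, cutCount_cons, Finset.sum_add_distrib, ih,
      sum_incInd]
    ring

theorem cutCount_inter_add_union_le (M : Multiset (Sym2 V)) (A B : Finset V) :
    cutCount M (A ∩ B) + cutCount M (A ∪ B) ≤ cutCount M A + cutCount M B := by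
  simp only [cutCount, ← Multiset.sum_map_add]
  refine Multiset.sum_map_le_sum_map _ _ fun e _ => ?_
  induction e using Sym2.ind with
  | _ a b =>
    simp only [cutInd_mk, Finset.mem_inter, Finset.mem_union]
    by_cases a ∈ A <;> by_cases a ∈ B <;> by_cases b ∈ A <;> by_cases b ∈ B <;> simp [*]

theorem cutCount_sdiff_add_sdiff_le (M : Multiset (Sym2 V)) (A B : Finset V) :
    cutCount M (A \ B) + cutCount M (B \ A) ≤ cutCount M A + cutCount M B := by
  simp only [cutCount, ← Multiset.sum_map_add]
  refine Multiset.sum_map_le_sum_map _ _ fun e _ => ?_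
  induction e using Sym2.ind with
  | _ a b =>
    simp only [cutInd_mk, Finset.mem_sdiff]
    by_cases a ∈ A <;> by_cases a ∈ B <;> by_cases b ∈ A <;> by_cases b ∈ B <;> simp [*]

theorem cutCount_congr {M : Multiset (Sym2 V)} {A B : Finset V}
    (h : ∀ a b, s(a, b) ∈ M → ((a ∈ A ↔ b ∈ A) ↔ (a ∈ B ↔ b ∈ B))) :
    cutCount M A = cutCount M B := by
  refine congrArg Multiset.sum (Multiset.map_congr rfl fun e he => ?_)
  induction e using Sym2.ind with
  | _ a b => simp only [cutInd_mk, h a b he]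

theorem exists_eq_cons_of_edgeDeg_ne_zero {M : Multiset (Sym2 V)} {v : V}
    (h : edgeDeg M v ≠ 0) : ∃ w N, M = s(v, w) ::ₘ N := by
  have : ∃ e ∈ M, v ∈ e := by
    by_contra! hc
    refine h (Multiset.sum_eq_zero fun n hn => ?_)
    obtain ⟨e, he, rfl⟩ := Multiset.mem_map.1 hn
    have := hc e he
    induction e using Sym2.ind with
    | _ a b =>
      simp only [Sym2.mem_iff, not_or] at this
      simp [Ne.symm this.1, Ne.symm this.2]
  obtain ⟨e, he, w, rfl⟩ := this
  exact ⟨w, Multiset.exists_cons_of_mem he⟩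

theorem notMem_of_edgeDeg_eq_zero {M : Multiset (Sym2 V)} {v : V} (h : edgeDeg M v = 0)
    {e : Sym2 V} (he : e ∈ M) : v ∉ e := by
  rintro ⟨w, rfl⟩
  obtain ⟨N, rfl⟩ := Multiset.exists_cons_of_mem he
  simp at h

theorem one_le_insideCount {M : Multiset (Sym2 V)} {A : Finset V} {a b : V}
    (h : s(a, b) ∈ M) (ha : a ∈ A) (hb : b ∈ A) : 1 ≤ insideCount M A := by
  obtain ⟨N, rfl⟩ := Multiset.exists_cons_of_mem h
  simp [ha, hb]

theorem exists_mem_of_insideCount_lt {M : Multiset (Sym2 V)} {A B : Finset V}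
    (h : ∑ v ∈ B, edgeDeg M v < insideCount M A) :
    ∃ a b, s(a, b) ∈ M ∧ a ∈ A ∧ b ∈ A ∧ a ∉ B ∧ b ∉ B := by
  by_contra! hc
  rw [sum_edgeDeg] at h
  refine absurd h (not_lt.2 ?_)
  have : insideCount M A ≤ insideCount M B + cutCount M B := by
    simp only [insideCount, cutCount, ← Multiset.sum_map_add]
    refine Multiset.sum_map_le_sum_map _ _ fun e he => ?_
    induction e using Sym2.ind with
    | _ a b =>
      have := hc a b he
      simp only [insideInd_mk, cutInd_mk]
      by_cases a ∈ A <;> by_cases a ∈ B <;> by_cases b ∈ A <;> by_cases b ∈ B <;> simp_all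
  omega

end EdgeCounts

section RootedCubic

variable {V : Type*} {S W : Finset V} {M : Multiset (Sym2 V)}

/-- The edge multiset `M` on the vertex set `S ∪ W` becomes a cubic 3-edge-connected graph once an
additional vertex is joined to the three elements of `S`. -/
structure RootedCubic (S W : Finset V) (M : Multiset (Sym2 V)) : Prop where
  card_roots : S.card = 3
  disjoint : Disjoint S W
  mem_of_mem : ∀ e ∈ M, ∀ v ∈ e, v ∈ S ∪ W
  edgeDeg_inner : ∀ v ∈ W, edgeDeg M v = 3
  edgeDeg_root : ∀ v ∈ S, edgeDeg M v = 2
  three_le : ∀ A ⊆ S ∪ W, A.Nonempty → 3 ≤ cutCount M A + (A ∩ S).card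

/-- A nontrivial set of vertices that is separated from its complement by only three edges. -/
structure IsTight (S W : Finset V) (M : Multiset (Sym2 V)) (A : Finset V) : Prop where
  subset : A ⊆ S ∪ W
  two_le_card : 2 ≤ A.card
  ne : A ≠ S ∪ W
  eq_three : cutCount M A + (A ∩ S).card = 3

namespace RootedCubic

theorem three_mul_card (h : RootedCubic S W M) {A : Finset V} (hA : A ⊆ S ∪ W) :
    3 * A.card = 2 * insideCount M A + (cutCount M A + (A ∩ S).card) := by
  rw [← add_assoc, ← sum_edgeDeg, ← Finset.sum_filter_add_sum_filter_not A (· ∈ S),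
    Finset.sum_congr rfl (g := fun _ => 2) fun v hv => h.edgeDeg_root v (Finset.mem_filter.1 hv).2,
    Finset.sum_congr rfl (g := fun _ => 3) fun v hv => h.edgeDeg_inner v ?_, Finset.sum_const,
    Finset.sum_const, ← Finset.card_filter_add_card_filter_not (s := A) (· ∈ S),
    Finset.filter_mem_eq_inter]
  · simp only [smul_eq_mul]; ring
  · have := hA (Finset.mem_filter.1 hv).1
    rw [Finset.mem_union] at this
    exact this.resolve_left (Finset.mem_filter.1 hv).2

theorem not_loop (h : RootedCubic S W M) {v : V} : s(v, v) ∉ M := by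
  intro hv
  have hU : {v} ⊆ S ∪ W := by simpa using h.mem_of_mem _ hv v (by simp)
  have h1 := h.three_mul_card hU
  have h2 := h.three_le _ hU (by simp)
  have h3 := one_le_insideCount hv (Finset.mem_singleton_self v) (Finset.mem_singleton_self v)
  simp only [Finset.card_singleton] at h1
  omega

theorem insideCount_pair_le (h : RootedCubic S W M) {a b : V} (ha : a ∈ S ∪ W) (hb : b ∈ S ∪ W)
    (hab : a ≠ b) : insideCount M {a, b} ≤ 1 := by
  have hU : {a, b} ⊆ S ∪ W := Finset.insert_subset ha (by simpa using hb)
  have h1 := h.three_mul_card hU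
  have h2 := h.three_le _ hU (by simp)
  rw [Finset.card_pair hab] at h1
  omega

theorem nodup (h : RootedCubic S W M) : M.Nodup := by
  rw [Multiset.nodup_iff_ne_cons_cons]
  intro e N hN
  induction e using Sym2.ind with
  | _ a b =>
    have hm : s(a, b) ∈ M := by simp [hN]
    have hab : a ≠ b := by rintro rfl; exact h.not_loop hm
    have := h.insideCount_pair_le (h.mem_of_mem _ hm a (by simp)) (h.mem_of_mem _ hm b (by simp))
      hab
    rw [hN] at this
    simp at this

theorem exists_inner_edge_of_isTight (h : RootedCubic S W M) {A : Finset V}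
    (hA : IsTight S W M A) :
    3 ≤ A.card ∧ ∃ a b, s(a, b) ∈ M ∧ a ∈ A ∧ b ∈ A ∧ a ∈ W ∧ b ∈ W := by
  have h1 := h.three_mul_card hA.subset
  have h2 := hA.eq_three
  have h3 := hA.two_le_card
  have hc : 3 ≤ A.card := by omega
  refine ⟨hc, ?_⟩
  have hne : ((S ∪ W) \ A).Nonempty :=
    Finset.sdiff_nonempty.2 fun hs => hA.ne (hA.subset.antisymm hs)
  have h4 := h.three_le _ Finset.sdiff_subset hne
  have h5 : cutCount M ((S ∪ W) \ A) = cutCount M A := cutCount_congr fun a b hab => by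
    have ha := h.mem_of_mem _ hab a (by simp)
    have hb := h.mem_of_mem _ hab b (by simp)
    simp only [Finset.mem_sdiff, ha, hb, true_and, not_iff_not]
  have h6 : (((S ∪ W) \ A) ∩ S).card + (A ∩ S).card = 3 := by
    rw [← h.card_roots, ← Finset.card_inter_add_card_sdiff S A, Finset.inter_comm S A, add_comm]
    congr 2
    ext v; simp only [Finset.mem_inter, Finset.mem_sdiff, Finset.mem_union]; tauto
  have h7 : ∑ v ∈ A ∩ S, edgeDeg M v < insideCount M A := by
    rw [Finset.sum_congr rfl (g := fun _ => 2) fun v hv =>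
      h.edgeDeg_root v (Finset.mem_inter.1 hv).2, Finset.sum_const, smul_eq_mul]
    omega
  obtain ⟨a, b, hab, ha, hb, ha', hb'⟩ := exists_mem_of_insideCount_lt h7
  have hW : ∀ v ∈ A, v ∉ A ∩ S → v ∈ W := fun v hv hv' =>
    (Finset.mem_union.1 (hA.subset hv)).resolve_left fun hs => hv' (Finset.mem_inter.2 ⟨hv, hs⟩)
  exact ⟨a, b, hab, ha, hb, hW a ha ha', hW b hb hb'⟩

/-- If there is an edge between inner vertices, one of them crosses no tight set. -/
theorem exists_removable_edge (h : RootedCubic S W M)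
    (hex : ∃ a b, s(a, b) ∈ M ∧ a ∈ W ∧ b ∈ W) :
    ∃ a b, s(a, b) ∈ M ∧ a ∈ W ∧ b ∈ W ∧ ∀ A, IsTight S W M A → (a ∈ A ↔ b ∈ A) := by
  by_cases hT : ∃ A, IsTight S W M A
  swap
  · obtain ⟨a, b, hab, ha, hb⟩ := hex
    exact ⟨a, b, hab, ha, hb, fun A hA => (hT ⟨A, hA⟩).elim⟩
  obtain ⟨A, hA, hmin⟩ := WellFounded.has_min (measure (Finset.card (α := V))).wf
    {A | IsTight S W M A} hT
  obtain ⟨hcard, a, b, hab, haA, hbA, haW, hbW⟩ := h.exists_inner_edge_of_isTight hA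
  have hmin' : ∀ B ⊆ A, B ≠ A → B.Nonempty → cutCount M B + (B ∩ S).card = 3 →
      B.card ≤ 1 := by
    intro B hBA hne _ h3
    by_contra! hB
    have hlt := Finset.card_lt_card (hBA.ssubset_of_ne hne)
    refine hmin B ⟨hBA.trans hA.subset, hB, ?_, h3⟩ hlt
    rintro rfl
    exact hne (hBA.antisymm hA.subset)
  have key : ∀ B, IsTight S W M B → ∀ u w, u ∈ A → w ∈ A → u ∈ B → w ∉ B → False := by
    intro B hB u w huA hwA huB hwB
    have hi : (A ∩ B).Nonempty := ⟨u, Finset.mem_inter.2 ⟨huA, huB⟩⟩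
    have hd : (A \ B).Nonempty := ⟨w, Finset.mem_sdiff.2 ⟨hwA, hwB⟩⟩
    have hsub := Finset.union_subset hA.subset hB.subset
    have i1 := h.three_le _ (Finset.inter_subset_union.trans hsub) hi
    have i2 := h.three_le _ hsub (hi.mono Finset.inter_subset_union)
    have i3 := cutCount_inter_add_union_le M A B
    have i4 := hA.eq_three
    have i5 := hB.eq_three
    have i6 : ((A ∩ B) ∩ S).card + ((A ∪ B) ∩ S).card = (A ∩ S).card + (B ∩ S).card := by
      rw [Finset.union_inter_distrib_right, Finset.inter_inter_distrib_right, add_comm,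
        Finset.card_union_add_card_inter]
    have hcI := hmin' (A ∩ B) Finset.inter_subset_left
      (fun he => hwB (Finset.inter_eq_left.1 he hwA)) hi (by omega)
    have hsplit := Finset.card_inter_add_card_sdiff A B
    rcases (B \ A).eq_empty_or_nonempty with hBA | hBA
    · have hBA' := Finset.sdiff_eq_empty_iff_subset.1 hBA
      rw [Finset.inter_eq_right.2 hBA'] at hcI
      have := hB.two_le_card
      omega
    · have j1 := h.three_le _ (Finset.sdiff_subset.trans hA.subset) hd
      have j2 := h.three_le _ (Finset.sdiff_subset.trans hB.subset) hBA
      have j3 := cutCount_sdiff_add_sdiff_le M A B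
      have j4 : ((A \ B) ∩ S).card ≤ (A ∩ S).card :=
        Finset.card_le_card (Finset.inter_subset_inter_right Finset.sdiff_subset)
      have j5 : ((B \ A) ∩ S).card ≤ (B ∩ S).card :=
        Finset.card_le_card (Finset.inter_subset_inter_right Finset.sdiff_subset)
      have hcD := hmin' (A \ B) Finset.sdiff_subset
        (fun he => (Finset.mem_sdiff.1 (he.symm ▸ huA : u ∈ A \ B)).2 huB) hd (by omega)
      omega
  exact ⟨a, b, hab, haW, hbW, fun B hB =>
    ⟨fun ha => by_contra fun hb => key B hB a b haA hbA ha hb,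
      fun hb => by_contra fun ha => key B hB b a hbA haA hb ha⟩⟩

/-- The edges at the two ends of an inner edge form an `H`. -/
theorem exists_H (h : RootedCubic S W M) {a b : V} (hab : s(a, b) ∈ M) (ha : a ∈ W)
    (hb : b ∈ W) : ∃ z₁ z₂ t₁ t₂ N,
      M = s(a, b) ::ₘ s(a, z₁) ::ₘ s(a, z₂) ::ₘ s(b, t₁) ::ₘ s(b, t₂) ::ₘ N ∧
      (z₁ ≠ a ∧ z₁ ≠ b) ∧ (z₂ ≠ a ∧ z₂ ≠ b) ∧ (t₁ ≠ a ∧ t₁ ≠ b) ∧ (t₂ ≠ a ∧ t₂ ≠ b) ∧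
      a ≠ b ∧ edgeDeg N a = 0 ∧ edgeDeg N b = 0 := by
  have hne : a ≠ b := by rintro rfl; exact h.not_loop hab
  have hpair := h.insideCount_pair_le (Finset.mem_union_right _ ha)
    (Finset.mem_union_right _ hb) hne
  have hloop := fun v => h.not_loop (v := v)
  have hda := h.edgeDeg_inner a ha
  have hdb := h.edgeDeg_inner b hb
  obtain ⟨M₁, rfl⟩ := Multiset.exists_cons_of_mem hab
  simp only [edgeDeg_cons, incInd_mk, if_true, hne, hne.symm, if_false] at hda hdb
  simp only [insideCount_cons, insideInd_mk, Finset.mem_insert, Finset.mem_singleton, true_or,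
    or_true, and_self, if_true] at hpair
  have step : ∀ {v w : V} {N : Multiset (Sym2 V)}, s(v, w) ∈ N → N ≤ M₁ →
      (v = a ∨ v = b) → w ≠ a ∧ w ≠ b := by
    intro v w N hvw hN hv
    have hm : s(v, w) ∈ M₁ := Multiset.mem_of_le hN hvw
    by_contra hw
    have : 1 ≤ insideCount M₁ {a, b} := one_le_insideCount hm (by simpa using hv) (by
      simp only [Finset.mem_insert, Finset.mem_singleton]; tauto)
    omega
  obtain ⟨z₁, M₂, rfl⟩ := exists_eq_cons_of_edgeDeg_ne_zero (M := M₁) (v := a) (by omega)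
  have hz₁ := step (Multiset.mem_cons_self _ M₂) le_rfl (Or.inl rfl)
  simp only [edgeDeg_cons, incInd_mk, if_true, hne, hz₁.1, hz₁.2, if_false] at hda hdb
  have l2 : M₂ ≤ s(a, z₁) ::ₘ M₂ := Multiset.le_cons_self _ _
  obtain ⟨z₂, M₃, rfl⟩ := exists_eq_cons_of_edgeDeg_ne_zero (M := M₂) (v := a) (by omega)
  have hz₂ := step (Multiset.mem_cons_self _ M₃) l2 (Or.inl rfl)
  simp only [edgeDeg_cons, incInd_mk, if_true, hne, hz₂.1, hz₂.2, if_false] at hda hdb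
  have l3 : M₃ ≤ _ := (Multiset.le_cons_self _ _).trans l2
  obtain ⟨t₁, M₄, rfl⟩ := exists_eq_cons_of_edgeDeg_ne_zero (M := M₃) (v := b) (by omega)
  have ht₁ := step (Multiset.mem_cons_self _ M₄) l3 (Or.inr rfl)
  simp only [edgeDeg_cons, incInd_mk, if_true, hne.symm, ht₁.1, ht₁.2, if_false] at hda hdb
  have l4 : M₄ ≤ _ := (Multiset.le_cons_self _ _).trans l3
  obtain ⟨t₂, M₅, rfl⟩ := exists_eq_cons_of_edgeDeg_ne_zero (M := M₄) (v := b) (by omega)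
  have ht₂ := step (Multiset.mem_cons_self _ M₅) l4 (Or.inr rfl)
  simp only [edgeDeg_cons, incInd_mk, if_true, hne.symm, ht₂.1, ht₂.2, if_false] at hda hdb
  exact ⟨z₁, z₂, t₁, t₂, M₅, rfl, hz₁, hz₂, ht₁, ht₂, hne, by omega, by omega⟩

/-- Replacing an `H` by two edges preserves `RootedCubic` if its crossbar crosses no tight set. -/
theorem replace_H {a b z₁ z₂ t₁ t₂ : V} {N : Multiset (Sym2 V)}
    (h : RootedCubic S W (s(a, b) ::ₘ s(a, z₁) ::ₘ s(a, z₂) ::ₘ s(b, t₁) ::ₘ s(b, t₂) ::ₘ N))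
    (hz₁ : z₁ ≠ a ∧ z₁ ≠ b) (hz₂ : z₂ ≠ a ∧ z₂ ≠ b) (ht₁ : t₁ ≠ a ∧ t₁ ≠ b)
    (ht₂ : t₂ ≠ a ∧ t₂ ≠ b) (hab : a ≠ b) (haN : edgeDeg N a = 0) (hbN : edgeDeg N b = 0)
    (ha : a ∈ W) (hb : b ∈ W)
    (hT : ∀ A, IsTight S W
      (s(a, b) ::ₘ s(a, z₁) ::ₘ s(a, z₂) ::ₘ s(b, t₁) ::ₘ s(b, t₂) ::ₘ N) A → (a ∈ A ↔ b ∈ A)) :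
    RootedCubic S ((W.erase a).erase b) (s(z₁, z₂) ::ₘ s(t₁, t₂) ::ₘ N) := by
  have haS : a ∉ S := fun hs => Finset.disjoint_left.1 h.disjoint hs ha
  have hbS : b ∉ S := fun hs => Finset.disjoint_left.1 h.disjoint hs hb
  have hdeg : ∀ v, v ≠ a → v ≠ b → edgeDeg (s(z₁, z₂) ::ₘ s(t₁, t₂) ::ₘ N) v =
      edgeDeg (s(a, b) ::ₘ s(a, z₁) ::ₘ s(a, z₂) ::ₘ s(b, t₁) ::ₘ s(b, t₂) ::ₘ N) v := by
    intro v hva hvb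
    simp only [edgeDeg_cons, incInd_mk, hva.symm, hvb.symm, if_false]
    ring
  have haN' := fun e he => notMem_of_edgeDeg_eq_zero haN (e := e) he
  have hbN' := fun e he => notMem_of_edgeDeg_eq_zero hbN (e := e) he
  refine ⟨h.card_roots, h.disjoint.mono_right
    ((Finset.erase_subset _ _).trans (Finset.erase_subset _ _)), ?_, ?_, ?_, ?_⟩
  · have hmem : ∀ v, v ∈ S ∪ W → v ≠ a → v ≠ b → v ∈ S ∪ (W.erase a).erase b := by
      intro v hv h1 h2
      simp only [Finset.mem_union, Finset.mem_erase] at hv ⊢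
      tauto
    have e1 := h.mem_of_mem s(a, z₁) (by simp) z₁ (by simp)
    have e2 := h.mem_of_mem s(a, z₂) (by simp) z₂ (by simp)
    have e3 := h.mem_of_mem s(b, t₁) (by simp) t₁ (by simp)
    have e4 := h.mem_of_mem s(b, t₂) (by simp) t₂ (by simp)
    intro e he v hv
    rcases Multiset.mem_cons.1 he with rfl | he
    · rcases Sym2.mem_iff.1 hv with rfl | rfl
      · exact hmem _ e1 hz₁.1 hz₁.2
      · exact hmem _ e2 hz₂.1 hz₂.2
    rcases Multiset.mem_cons.1 he with rfl | he
    · rcases Sym2.mem_iff.1 hv with rfl | rfl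
      · exact hmem _ e3 ht₁.1 ht₁.2
      · exact hmem _ e4 ht₂.1 ht₂.2
    exact hmem v (h.mem_of_mem e (by simp [he]) v hv)
      (fun hva => haN' e he (hva ▸ hv)) (fun hvb => hbN' e he (hvb ▸ hv))
  · intro v hv
    simp only [Finset.mem_erase] at hv
    rw [hdeg v hv.2.1 hv.1, h.edgeDeg_inner v hv.2.2]
  · intro v hv
    rw [hdeg v (fun he => haS (he ▸ hv)) (fun he => hbS (he ▸ hv)), h.edgeDeg_root v hv]
  · intro A hA hne
    have haA : a ∉ A := fun hm => by
      have := hA hm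
      simp only [Finset.mem_union, Finset.mem_erase] at this
      tauto
    have hbA : b ∉ A := fun hm => by
      have := hA hm
      simp only [Finset.mem_union, Finset.mem_erase] at this
      tauto
    have hAU : A ⊆ S ∪ W := hA.trans (Finset.union_subset_union_right
      ((Finset.erase_subset _ _).trans (Finset.erase_subset _ _)))
    have haU : a ∈ S ∪ W := Finset.mem_union_right _ ha
    have hbU : b ∈ S ∪ W := Finset.mem_union_right _ hb
    have aAU : insert a A ⊆ S ∪ W := Finset.insert_subset haU hAU
    have bAU : insert b A ⊆ S ∪ W := Finset.insert_subset hbU hAU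
    have abAU : insert a (insert b A) ⊆ S ∪ W := Finset.insert_subset haU bAU
    have c0 := h.three_le A hAU hne
    have ca := h.three_le _ aAU (Finset.insert_nonempty _ _)
    have cb := h.three_le _ bAU (Finset.insert_nonempty _ _)
    have cab := h.three_le _ abAU (Finset.insert_nonempty _ _)
    have hpos : 1 ≤ A.card := hne.card_pos
    have ca' : cutCount _ (insert a A) + (insert a A ∩ S).card ≠ 3 := fun he => by
      have := hT (insert a A) ⟨aAU, by rw [Finset.card_insert_of_notMem haA]; omega,
        fun hh => by
          have : b ∈ insert a A := hh ▸ hbU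
          simp [hab.symm, hbA] at this, he⟩
      simp [hab.symm, hbA] at this
    have cb' : cutCount _ (insert b A) + (insert b A ∩ S).card ≠ 3 := fun he => by
      have := hT (insert b A) ⟨bAU, by rw [Finset.card_insert_of_notMem hbA]; omega,
        fun hh => by
          have : a ∈ insert b A := hh ▸ haU
          simp [hab, haA] at this, he⟩
      simp [hab, haA] at this
    have hN : ∀ B, (∀ v, v ≠ a → v ≠ b → (v ∈ B ↔ v ∈ A)) → cutCount N B = cutCount N A := by
      intro B hB
      refine cutCount_congr fun u w huw => ?_
      have h1 := haN' _ huw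
      have h2 := hbN' _ huw
      simp only [Sym2.mem_iff, not_or] at h1 h2
      rw [hB u (Ne.symm h1.1) (Ne.symm h2.1), hB w (Ne.symm h1.2) (Ne.symm h2.2)]
    have na := hN (insert a A) fun v hva _ => by simp [hva]
    have nb := hN (insert b A) fun v _ hvb => by simp [hvb]
    have nab := hN (insert a (insert b A)) fun v hva hvb => by simp [hva, hvb]
    simp only [Finset.insert_inter_of_notMem haS, Finset.insert_inter_of_notMem hbS,
      cutCount_cons, cutInd_mk, na, nb, nab, Finset.mem_insert, hz₁, hz₂, ht₁, ht₂, hab, hab.symm,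
      false_or, or_true, or_false, haA, hbA, true_iff, false_iff, iff_true, if_true,
      if_false] at c0 ca cb cab ca' cb' ⊢
    by_cases p1 : z₁ ∈ A <;> by_cases p2 : z₂ ∈ A <;> by_cases p3 : t₁ ∈ A <;>
      by_cases p4 : t₂ ∈ A <;>
      simp only [p1, p2, p3, p4, not_true_eq_false, not_false_eq_true, if_true, if_false, iff_true,
        iff_false] at c0 ca cb cab ca' cb' ⊢ <;> omega

end RootedCubic

end RootedCubic

section Diagrams

variable {V : Type*} {α : Type*}

/-- The product of the edge weights at a given labelling. -/
noncomputable def edgeProd (w : Sym2 α → ℝ≥0∞) (M : Multiset (Sym2 V)) (f : V → α) : ℝ≥0∞ :=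
  (M.map fun e => w (e.map f)).prod

@[simp] theorem edgeProd_cons (w : Sym2 α → ℝ≥0∞) (e : Sym2 V) (M : Multiset (Sym2 V))
    (f : V → α) : edgeProd w (e ::ₘ M) f = w (e.map f) * edgeProd w M f := by simp [edgeProd]

@[simp] theorem edgeProd_singleton (w : Sym2 α → ℝ≥0∞) (e : Sym2 V) (f : V → α) :
    edgeProd w {e} f = w (e.map f) := by simp [edgeProd]

/-- The diagram with edge multiset `M` and edge weight `w`, summed over the labels of the vertices
in `W`, all other vertices being labelled by `ℓ`. -/
noncomputable def diagSum (w : Sym2 α → ℝ≥0∞) (W : Finset V) (M : Multiset (Sym2 V))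
    (ℓ : V → α) : ℝ≥0∞ :=
  ∑' f : {f : V → α // ∀ v, v ∉ W → f v = ℓ v}, edgeProd w M f.1

/-- A labelling of `W` amounts to a labelling of `W.erase a` and a label for `a`. -/
noncomputable def labellingEquiv {W : Finset V} {a : V} (ha : a ∈ W) (ℓ : V → α) :
    {f : V → α // ∀ v, v ∉ W → f v = ℓ v} ≃
      {g : V → α // ∀ v, v ∉ W.erase a → g v = ℓ v} × α where
  toFun f := (⟨Function.update f.1 a (ℓ a), fun v hv => by
    by_cases hva : v = a
    · simp [hva]
    · simpa [hva] using f.2 v fun hW => hv (Finset.mem_erase.2 ⟨hva, hW⟩)⟩, f.1 a)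
  invFun p := ⟨Function.update p.1.1 a p.2, fun v hv => by
    have hva : v ≠ a := fun h => hv (h ▸ ha)
    simpa [hva] using p.1.2 v fun h => hv (Finset.mem_of_mem_erase h)⟩
  left_inv f := by simp
  right_inv p := by
    have : p.1.1 a = ℓ a := p.1.2 a (by simp)
    ext <;> simp [← this]

theorem tsum_labelling {W : Finset V} {a : V} (ha : a ∈ W) (ℓ : V → α)
    (F : (V → α) → ℝ≥0∞) :
    ∑' f : {f : V → α // ∀ v, v ∉ W → f v = ℓ v}, F f.1 =
      ∑' g : {g : V → α // ∀ v, v ∉ W.erase a → g v = ℓ v}, ∑' t,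
        F (Function.update g.1 a t) := by
  rw [← (labellingEquiv ha ℓ).symm.tsum_eq, ENNReal.tsum_prod']
  rfl

theorem tsum_labelling_empty (ℓ : V → α) (F : (V → α) → ℝ≥0∞) :
    ∑' f : {f : V → α // ∀ v, v ∉ (∅ : Finset V) → f v = ℓ v}, F f.1 = F ℓ := by
  have : ∀ f : {f : V → α // ∀ v, v ∉ (∅ : Finset V) → f v = ℓ v}, f = ⟨ℓ, fun _ _ => rfl⟩ :=
    fun f => Subtype.ext (funext fun v => f.2 v (Finset.notMem_empty v))
  exact tsum_eq_single (f := fun f : {f : V → α // ∀ v, v ∉ (∅ : Finset V) → f v = ℓ v} => F f.1)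
    ⟨ℓ, fun _ _ => rfl⟩ fun f hf => (hf (this f)).elim

theorem Sym2.map_update_of_notMem {e : Sym2 V} {a : V} (h : a ∉ e) (f : V → α) (t : α) :
    e.map (Function.update f a t) = e.map f := by
  refine Sym2.map_congr fun v hv => Function.update_of_ne ?_ _ _
  rintro rfl
  exact h hv

variable {r : α → α → ℝ≥0∞} {K T : ℝ≥0∞} {w : Sym2 α → ℝ≥0∞}

theorem PairKernel.diagSum_H_le (hr : PairKernel r K T) (hw : ∀ a b, w s(a, b) = r a b ^ 2)
    {W : Finset V} {a b z₁ z₂ t₁ t₂ : V} {N : Multiset (Sym2 V)}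
    (hz₁ : z₁ ≠ a ∧ z₁ ≠ b) (hz₂ : z₂ ≠ a ∧ z₂ ≠ b) (ht₁ : t₁ ≠ a ∧ t₁ ≠ b)
    (ht₂ : t₂ ≠ a ∧ t₂ ≠ b) (hab : a ≠ b) (haN : edgeDeg N a = 0) (hbN : edgeDeg N b = 0)
    (ha : a ∈ W) (hb : b ∈ W) (ℓ : V → α) :
    diagSum w W (s(a, b) ::ₘ s(a, z₁) ::ₘ s(a, z₂) ::ₘ s(b, t₁) ::ₘ s(b, t₂) ::ₘ N) ℓ ≤
      (K ^ 4 * (288 * T ^ 2)) *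
        diagSum w ((W.erase a).erase b) (s(z₁, z₂) ::ₘ s(t₁, t₂) ::ₘ N) ℓ := by
  have hb' : b ∈ W.erase a := Finset.mem_erase.2 ⟨hab.symm, hb⟩
  rw [diagSum, tsum_labelling ha ℓ fun f => edgeProd w _ f,
    tsum_labelling hb' ℓ fun g => ∑' t, edgeProd w _ (Function.update g a t), diagSum,
    ← ENNReal.tsum_mul_left]
  refine ENNReal.tsum_le_tsum fun ⟨g, _⟩ => ?_
  have hN : ∀ p q, edgeProd w N (Function.update (Function.update g b q) a p) =
      edgeProd w N g := fun p q => congrArg Multiset.prod <| Multiset.map_congr rfl fun e he => by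
    rw [Sym2.map_update_of_notMem (notMem_of_edgeDeg_eq_zero haN he),
      Sym2.map_update_of_notMem (notMem_of_edgeDeg_eq_zero hbN he)]
  have hH := hr.tsum_H_le (g z₁) (g z₂) (g t₁) (g t₂)
  rw [ENNReal.tsum_comm]
  simp only [edgeProd_cons, hN, Sym2.map_mk, Function.update_self, hw,
    Function.update_of_ne hz₁.1, Function.update_of_ne hz₁.2, Function.update_of_ne hz₂.1,
    Function.update_of_ne hz₂.2, Function.update_of_ne ht₁.1, Function.update_of_ne ht₁.2,
    Function.update_of_ne ht₂.1, Function.update_of_ne ht₂.2, Function.update_of_ne hab.symm]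
  calc _ = (∑' p, ∑' q, r p q ^ 2 * (r p (g z₁) ^ 2 * r p (g z₂) ^ 2) *
          (r q (g t₁) ^ 2 * r q (g t₂) ^ 2)) * edgeProd w N g := by
        simp_rw [← ENNReal.tsum_mul_right]
        refine tsum_congr fun p => tsum_congr fun q => by ring
    _ ≤ (K ^ 4 * (288 * T ^ 2)) * (r (g z₁) (g z₂) ^ 2 * r (g t₁) (g t₂) ^ 2) *
          edgeProd w N g := by gcongr
    _ = _ := by ring

namespace RootedCubic

variable {S W : Finset V} {M : Multiset (Sym2 V)}

theorem card_eq_of_no_inner_edge (h : RootedCubic S W M)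
    (hno : ∀ a b, s(a, b) ∈ M → a ∈ W → b ∉ W) :
    (W.card = 0 ∧ M.card = 3) ∨ (W.card = 2 ∧ M.card = 6 ∧ insideCount M S = 0) := by
  have hW := h.three_mul_card (Finset.subset_union_right : W ⊆ S ∪ W)
  have hS := h.three_mul_card (Finset.subset_union_left : S ⊆ S ∪ W)
  have hU := h.three_mul_card (subset_refl (S ∪ W))
  have hW0 : insideCount M W = 0 := by
    by_contra hne
    obtain ⟨a, b, hab, ha, hb, -⟩ := exists_mem_of_insideCount_lt (M := M) (A := W) (B := ∅)
      (by rw [Finset.sum_empty]; omega)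
    exact hno a b hab ha hb
  have hcut : cutCount M W = cutCount M S := cutCount_congr fun a b hab => by
    have ha := h.mem_of_mem _ hab a (by simp)
    have hb := h.mem_of_mem _ hab b (by simp)
    rw [Finset.mem_union] at ha hb
    have hd : ∀ v ∈ S, v ∉ W := fun v hv => Finset.disjoint_left.1 h.disjoint hv
    have ha' := hd a
    have hb' := hd b
    tauto
  have hcutU : cutCount M (S ∪ W) = 0 := by
    rw [cutCount_congr (B := ∅), cutCount]
    · refine Multiset.sum_eq_zero fun n hn => ?_
      obtain ⟨e, he, rfl⟩ := Multiset.mem_map.1 hn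
      induction e using Sym2.ind with
      | _ a b => simp
    · intro a b hab
      simp [h.mem_of_mem _ hab a (by simp), h.mem_of_mem _ hab b (by simp)]
  have hin : insideCount M (S ∪ W) = M.card := by
    rw [insideCount, Multiset.map_congr rfl (g := fun _ => 1)]
    · simp
    · intro e he
      induction e using Sym2.ind with
      | _ a b => rw [insideInd_mk, if_pos ⟨h.mem_of_mem _ he a (by simp),
          h.mem_of_mem _ he b (by simp)⟩]
  rw [Finset.disjoint_iff_inter_eq_empty.1 h.disjoint.symm, Finset.card_empty] at hW
  rw [Finset.inter_self, h.card_roots] at hS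
  rw [Finset.card_union_of_disjoint h.disjoint, Finset.inter_eq_right.2 Finset.subset_union_left,
    h.card_roots] at hU
  omega

/-- Without inner edges the graph is a triangle or a `K_{2,3}`. -/
theorem eq_of_no_inner_edge {x y z : V} (h : RootedCubic {x, y, z} W M)
    (hno : ∀ a b, s(a, b) ∈ M → a ∈ W → b ∉ W) :
    (W = ∅ ∧ M = {s(x, y), s(x, z), s(y, z)}) ∨
      ∃ p q, p ≠ q ∧ W = {p, q} ∧
        M = {s(p, x), s(p, y), s(p, z), s(q, x), s(q, y), s(q, z)} := by
  rcases h.card_eq_of_no_inner_edge hno with ⟨h1, h2⟩ | ⟨h1, h2, h3⟩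
  · left
    obtain rfl := Finset.card_eq_zero.1 h1
    refine ⟨rfl,
      Multiset.eq_of_le_of_card_le ((Multiset.le_iff_subset h.nodup).2 ?_) (by simp [h2])⟩
    intro e he
    induction e using Sym2.ind with
    | _ a b =>
      have hab : a ≠ b := by rintro rfl; exact h.not_loop he
      have ha := h.mem_of_mem _ he a (by simp)
      have hb := h.mem_of_mem _ he b (by simp)
      simp only [Finset.union_empty, Finset.mem_insert, Finset.mem_singleton] at ha hb
      rcases ha with rfl | rfl | rfl <;> rcases hb with rfl | rfl | rfl <;>
        first | exact absurd rfl hab | simp [Sym2.eq_swap]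
  · right
    obtain ⟨p, q, hpq, rfl⟩ := Finset.card_eq_two.1 h1
    refine ⟨p, q, hpq, rfl,
      Multiset.eq_of_le_of_card_le ((Multiset.le_iff_subset h.nodup).2 ?_) (by simp [h2])⟩
    have key : ∀ a b, s(a, b) ∈ M → a ∈ ({p, q} : Finset V) →
        s(a, b) ∈ ({s(p, x), s(p, y), s(p, z), s(q, x), s(q, y), s(q, z)} :
          Multiset (Sym2 V)) := by
      intro a b he ha
      have hb := (Finset.mem_union.1 (h.mem_of_mem _ he b (by simp))).resolve_right (hno a b he ha)
      simp only [Finset.mem_insert, Finset.mem_singleton] at ha hb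
      rcases ha with rfl | rfl <;> rcases hb with rfl | rfl | rfl <;> simp
    intro e he
    induction e using Sym2.ind with
    | _ a b =>
      rcases Finset.mem_union.1 (h.mem_of_mem _ he a (by simp)) with ha | ha
      · rcases Finset.mem_union.1 (h.mem_of_mem _ he b (by simp)) with hb | hb
        · have := one_le_insideCount he ha hb
          omega
        · have : s(a, b) = s(b, a) := Sym2.eq_swap
          rw [this] at he ⊢
          exact key b a he hb
      · exact key a b he ha

theorem diagSum_le {x y z : V} {W : Finset V} {M : Multiset (Sym2 V)}
    (hr : PairKernel r K T) (hw : ∀ a b, w s(a, b) = r a b ^ 2) (h : RootedCubic {x, y, z} W M) (ℓ : V → α) :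
    diagSum w W M ℓ ≤ (K ^ 4 * (288 * T ^ 2) + (K ^ 3 * (48 * T)) ^ 2 + 1) ^ M.card *
      (r (ℓ x) (ℓ y) * r (ℓ x) (ℓ z) * r (ℓ y) (ℓ z)) ^ 2 := by
  set C := K ^ 4 * (288 * T ^ 2) + (K ^ 3 * (48 * T)) ^ 2 + 1
  have hC1 : 1 ≤ C := le_add_self
  by_cases hex : ∃ a b, s(a, b) ∈ M ∧ a ∈ W ∧ b ∈ W
  · obtain ⟨a, b, hab, ha, hb, hT⟩ := h.exists_removable_edge hex
    obtain ⟨z₁, z₂, t₁, t₂, N, hM, hz₁, hz₂, ht₁, ht₂, hne, haN, hbN⟩ := h.exists_H hab ha hb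
    have hlt : (s(z₁, z₂) ::ₘ s(t₁, t₂) ::ₘ N).card < M.card := by simp [hM]
    have h' : RootedCubic {x, y, z} ((W.erase a).erase b) (s(z₁, z₂) ::ₘ s(t₁, t₂) ::ₘ N) := by
      rw [hM] at h hT
      exact h.replace_H hz₁ hz₂ ht₁ ht₂ hne haN hbN ha hb hT
    have ih := diagSum_le hr hw h' ℓ
    calc diagSum w W M ℓ ≤ (K ^ 4 * (288 * T ^ 2)) *
          diagSum w ((W.erase a).erase b) (s(z₁, z₂) ::ₘ s(t₁, t₂) ::ₘ N) ℓ := by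
          rw [hM]
          exact hr.diagSum_H_le hw hz₁ hz₂ ht₁ ht₂ hne haN hbN ha hb ℓ
      _ ≤ C * (C ^ (s(z₁, z₂) ::ₘ s(t₁, t₂) ::ₘ N).card *
          (r (ℓ x) (ℓ y) * r (ℓ x) (ℓ z) * r (ℓ y) (ℓ z)) ^ 2) := by
          gcongr
          exact le_self_add.trans le_self_add
      _ = C ^ ((s(z₁, z₂) ::ₘ s(t₁, t₂) ::ₘ N).card + 1) *
          (r (ℓ x) (ℓ y) * r (ℓ x) (ℓ z) * r (ℓ y) (ℓ z)) ^ 2 := by ring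
      _ ≤ _ := by
          gcongr
          exact hlt
  · push Not at hex
    rcases h.eq_of_no_inner_edge hex with ⟨rfl, hM⟩ | ⟨p, q, hpq, rfl, hM⟩
    · rw [diagSum, tsum_labelling_empty ℓ fun f => edgeProd w M f]
      calc _ = 1 * (r (ℓ x) (ℓ y) * r (ℓ x) (ℓ z) * r (ℓ y) (ℓ z)) ^ 2 := by
            simp [hM, hw]; ring
        _ ≤ _ := by gcongr; exact one_le_pow₀ hC1
    · have hS : ∀ v ∈ ({x, y, z} : Finset V), v ≠ p ∧ v ≠ q := fun v hv => by
        have := Finset.disjoint_left.1 h.disjoint hv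
        simpa using this
      have hx := hS x (by simp)
      have hy := hS y (by simp)
      have hz := hS z (by simp)
      have hq : q ∈ ({p, q} : Finset V).erase p := by simp [hpq.symm]
      have he : (({p, q} : Finset V).erase p).erase q = ∅ := by
        ext v; simp only [Finset.mem_erase, Finset.mem_insert, Finset.mem_singleton,
          Finset.notMem_empty]; tauto
      rw [diagSum, tsum_labelling (a := p) (by simp) ℓ
          fun f => edgeProd w M f,
        tsum_labelling hq ℓ fun g => ∑' t, edgeProd w M (Function.update g p t), he,
        tsum_labelling_empty ℓ fun g =>
          ∑' t', ∑' t, edgeProd w M (Function.update (Function.update g q t') p t)]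
      have hstar := hr.tsum_star_le (ℓ x) (ℓ y) (ℓ z)
      calc _ = (∑' p, r p (ℓ x) ^ 2 * r p (ℓ y) ^ 2 * r p (ℓ z) ^ 2) ^ 2 := by
            rw [pow_two, ← ENNReal.tsum_mul_right]
            simp_rw [← ENNReal.tsum_mul_left]
            refine tsum_congr fun s => tsum_congr fun t => ?_
            rw [hM]
            simp only [Multiset.insert_eq_cons, edgeProd_cons, edgeProd_singleton, Sym2.map_mk,
              Function.update_self, hw,
              Function.update_of_ne hx.1, Function.update_of_ne hx.2, Function.update_of_ne hy.1,
              Function.update_of_ne hy.2, Function.update_of_ne hz.1, Function.update_of_ne hz.2,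
              Function.update_of_ne hpq.symm]
            ring
        _ ≤ (K ^ 3 * (48 * T) * (r (ℓ x) (ℓ y) * r (ℓ x) (ℓ z) * r (ℓ y) (ℓ z))) ^ 2 := by gcongr
        _ = (K ^ 3 * (48 * T)) ^ 2 * (r (ℓ x) (ℓ y) * r (ℓ x) (ℓ z) * r (ℓ y) (ℓ z)) ^ 2 := by
            ring
        _ ≤ C ^ 1 * (r (ℓ x) (ℓ y) * r (ℓ x) (ℓ z) * r (ℓ y) (ℓ z)) ^ 2 := by
            rw [pow_one]
            gcongr
            exact le_add_self.trans le_self_add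
        _ ≤ _ := by
            gcongr
            rw [hM]
            simp
termination_by M.card

end RootedCubic

end Diagrams

section FromMultigraph

variable {V : Type}

theorem exists_listEdges_crossing {R : V → V → Prop} {A : Finset V} {l : List V} {a b : V}
    (hl : l.IsChain R) (ha : l.head? = some a) (hb : l.getLast? = some b) (haA : a ∈ A)
    (hbA : b ∉ A) : ∃ u v, s(u, v) ∈ listEdges l ∧ R u v ∧ u ∈ A ∧ v ∉ A := by
  induction l generalizing a with
  | nil => simp at ha
  | cons p l ih =>
    obtain rfl : p = a := by simpa using ha
    cases l with
    | nil =>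
      obtain rfl : p = b := by simpa using hb
      exact (hbA haA).elim
    | cons q l =>
      rw [List.isChain_cons_cons] at hl
      by_cases hq : q ∈ A
      · obtain ⟨u, v, huv, h⟩ := ih hl.2 rfl (by simpa using hb) hq
        exact ⟨u, v, List.mem_cons_of_mem _ huv, h⟩
      · exact ⟨p, q, List.mem_cons_self, hl.1, haA, hq⟩

namespace Multigraph

variable {G : Multigraph V}

/-- The edges of `G`, without multiplicity. -/
noncomputable def edgeFinset (G : Multigraph V) : Finset (Sym2 V) :=
  G.verts.sym2.filter fun e => G.mult e ≠ 0

theorem mem_edgeFinset {e : Sym2 V} : e ∈ G.edgeFinset ↔ G.mult e ≠ 0 := by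
  rw [edgeFinset, Finset.mem_filter, Finset.mem_sym2_iff]
  exact ⟨And.right, fun h => ⟨G.supp e h, h⟩⟩

theorem IsSimple.mult_eq_one (h : G.IsSimple) {e : Sym2 V} (he : e ∈ G.edgeFinset) :
    G.mult e = 1 := by
  have := h.1 e
  have := mem_edgeFinset.1 he
  omega

theorem IsSimple.ne_of_mem (h : G.IsSimple) {a b : V} (he : s(a, b) ∈ G.edgeFinset) : a ≠ b := by
  rintro rfl
  exact mem_edgeFinset.1 he (h.2 a)

theorem IsSimple.card_edgeFinset (h : G.IsSimple) : G.edgeFinset.card = G.numEdges := by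
  rw [numEdges, ← Finset.sum_filter_ne_zero, Finset.card_eq_sum_ones]
  exact Finset.sum_congr rfl fun e he => (h.mult_eq_one he).symm

theorem IsSimple.edgeDeg_eq (h : G.IsSimple) (v : V) : edgeDeg G.edgeFinset.val v = G.deg v := by
  have h1 : edgeDeg G.edgeFinset.val v = (G.edgeFinset.filter (v ∈ ·)).card := by
    rw [Finset.card_filter]
    refine Finset.sum_congr rfl fun e he => ?_
    induction e using Sym2.ind with
    | _ a b =>
      have := h.ne_of_mem he
      by_cases ha : a = v
      · subst ha; simp [this.symm]
      · simp [ha, Sym2.mem_iff, Ne.symm ha, eq_comm]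
  have h2 : G.deg v = (G.verts.filter fun u => G.mult s(v, u) ≠ 0).card := by
    rw [Finset.card_filter, deg, nbrs, Multiset.card_bind]
    refine Finset.sum_congr rfl fun u _ => ?_
    have := h.1 s(v, u)
    simp only [Function.comp_apply, Multiset.card_replicate]
    split_ifs <;> omega
  rw [h1, h2]
  refine (Finset.card_bij (fun u _ => s(v, u)) ?_ ?_ ?_).symm
  · intro u hu
    simpa [mem_edgeFinset] using (Finset.mem_filter.1 hu).2
  · intro u _ u' _ he
    exact Sym2.congr_right.1 he
  · intro e he
    obtain ⟨he, u, rfl⟩ := Finset.mem_filter.1 he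
    have hm := mem_edgeFinset.1 he
    exact ⟨u, Finset.mem_filter.2 ⟨G.supp _ hm u (by simp), hm⟩, rfl⟩

theorem IsSimple.insideCount_singleton (h : G.IsSimple) (a : V) :
    insideCount G.edgeFinset.val {a} = 0 := by
  refine Finset.sum_eq_zero fun e he => ?_
  induction e using Sym2.ind with
  | _ u v =>
    have := h.ne_of_mem he
    rw [insideInd_mk, if_neg]
    simp only [Finset.mem_singleton]
    rintro ⟨rfl, rfl⟩
    exact this rfl

theorem IsSimple.insideCount_pair_le (h : G.IsSimple) (a b : V) :
    insideCount G.edgeFinset.val {a, b} ≤ 1 := by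
  calc ∑ e ∈ G.edgeFinset, insideInd {a, b} e
      ≤ ∑ e ∈ G.edgeFinset, if e = s(a, b) then 1 else 0 := by
        refine Finset.sum_le_sum fun e he => ?_
        induction e using Sym2.ind with
        | _ u v =>
          have := h.ne_of_mem he
          rw [insideInd_mk]
          by_cases hc : u ∈ ({a, b} : Finset V) ∧ v ∈ ({a, b} : Finset V)
          · rw [if_pos hc, if_pos]
            simp only [Finset.mem_insert, Finset.mem_singleton] at hc
            rw [Sym2.eq_iff]
            grind
          · rw [if_neg hc]; exact Nat.zero_le _
    _ ≤ 1 := by rw [Finset.sum_ite_eq']; split_ifs <;> simp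

theorem ThreeConnFrom.three_le {x y z v : V} (h : G.ThreeConnFrom x y z v) {A : Finset V}
    (hv : v ∈ A) : 3 ≤ cutCount G.edgeFinset.val A + ((if x ∈ A then 1 else 0) +
      (if y ∈ A then 1 else 0) + (if z ∈ A then 1 else 0)) := by
  obtain ⟨l₁, l₂, l₃, h₁, h₂, h₃, h₁₂, h₁₃, h₂₃⟩ := h
  set F : List V → Finset (Sym2 V) := fun l =>
    G.edgeFinset.filter fun e => e ∈ listEdges l ∧ cutInd A e = 1 with hF
  have hone : ∀ {s l}, G.IsPathBetween v s l → 1 ≤ (F l).card + if s ∈ A then 1 else 0 := by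
    intro s l hl
    by_cases hs : s ∈ A
    · simp [hs]
    obtain ⟨a, b, hab, hadj, ha, hb⟩ :=
      exists_listEdges_crossing hl.1.2.2.2 hl.2.1 hl.2.2 hv hs
    have : s(a, b) ∈ F l := Finset.mem_filter.2 ⟨mem_edgeFinset.2 hadj.2, hab, by simp [ha, hb]⟩
    have := Finset.card_pos.2 ⟨_, this⟩
    omega
  have hdisj : ∀ {l l'}, (listEdges l).Disjoint (listEdges l') → Disjoint (F l) (F l') :=
    fun hd => Finset.disjoint_left.2 fun e he he' =>
      hd (Finset.mem_filter.1 he).2.1 (Finset.mem_filter.1 he').2.1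
  have hcard : (F l₁).card + (F l₂).card + (F l₃).card ≤ cutCount G.edgeFinset.val A := by
    rw [← Finset.card_union_of_disjoint (hdisj h₁₂), ← Finset.card_union_of_disjoint
      (Finset.disjoint_union_left.2 ⟨hdisj h₁₃, hdisj h₂₃⟩), Finset.card_eq_sum_ones]
    have hsub : F l₁ ∪ F l₂ ∪ F l₃ ⊆ G.edgeFinset :=
      Finset.union_subset (Finset.union_subset (Finset.filter_subset _ _)
        (Finset.filter_subset _ _)) (Finset.filter_subset _ _)
    refine le_trans (Finset.sum_le_sum fun e he => ?_)
      (Finset.sum_le_sum_of_subset (f := cutInd A) hsub)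
    simp only [hF, Finset.mem_union, Finset.mem_filter] at he
    rcases he with (he | he) | he <;> exact he.2.2.ge
  have a1 := hone h₁
  have a2 := hone h₂
  have a3 := hone h₃
  omega

theorem rootedCubic {x y z : V} (hxy : x ≠ y) (hxz : x ≠ z) (hyz : y ≠ z) (hx : x ∈ G.verts)
    (hy : y ∈ G.verts) (hz : z ∈ G.verts) (hG : G.IsSimple) (hconn : G.ThreeConnTo x y z)
    (hdeg : ∀ v ∈ G.verts, v ≠ x → v ≠ y → v ≠ z → G.deg v = 3)
    (hdx : G.deg x = 2) (hdy : G.deg y = 2) (hdz : G.deg z = 2) :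
    RootedCubic {x, y, z} (G.verts \ {x, y, z}) G.edgeFinset.val := by
  have hS : ({x, y, z} : Finset V) ⊆ G.verts :=
    Finset.insert_subset hx (Finset.insert_subset hy (Finset.singleton_subset_iff.2 hz))
  have hroot : ∀ v ∈ ({x, y, z} : Finset V), edgeDeg G.edgeFinset.val v = 2 := by
    intro v hv
    rw [hG.edgeDeg_eq]
    simp only [Finset.mem_insert, Finset.mem_singleton] at hv
    rcases hv with rfl | rfl | rfl <;> assumption
  have hcard : ({x, y, z} : Finset V).card = 3 :=
    Finset.card_eq_three.2 ⟨x, y, z, hxy, hxz, hyz, rfl⟩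
  have hU := Finset.union_sdiff_of_subset hS
  refine ⟨hcard, Finset.disjoint_sdiff, ?_, ?_, hroot, ?_⟩
  · intro e he v hv
    rw [hU]
    exact G.supp e (mem_edgeFinset.1 he) v hv
  · intro v hv
    simp only [Finset.mem_sdiff, Finset.mem_insert, Finset.mem_singleton, not_or] at hv
    rw [hG.edgeDeg_eq, hdeg v hv.1 hv.2.1 hv.2.2.1 hv.2.2.2]
  · intro A hA hne
    rw [hU] at hA
    by_cases hAS : A ⊆ {x, y, z}
    · rw [Finset.inter_eq_left.2 hAS]
      have hsum := sum_edgeDeg G.edgeFinset.val A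
      rw [Finset.sum_congr rfl fun v hv => hroot v (hAS hv), Finset.sum_const, smul_eq_mul] at hsum
      have hpos := hne.card_pos
      have hle := (Finset.card_le_card hAS).trans_eq hcard
      obtain h1 | h2 | h3 : A.card = 1 ∨ A.card = 2 ∨ A.card = 3 := by omega
      · obtain ⟨a, rfl⟩ := Finset.card_eq_one.1 h1
        have := hG.insideCount_singleton a
        omega
      · obtain ⟨a, b, -, rfl⟩ := Finset.card_eq_two.1 h2
        have := hG.insideCount_pair_le a b
        omega
      · omega
    · obtain ⟨v, hv, hvS⟩ := Finset.not_subset.1 hAS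
      simp only [Finset.mem_insert, Finset.mem_singleton, not_or] at hvS
      have := (hconn v (hA hv) hvS.1 hvS.2.1 hvS.2.2).three_le hv
      have hc : (A ∩ {x, y, z}).card = (if x ∈ A then 1 else 0) +
          (if y ∈ A then 1 else 0) + (if z ∈ A then 1 else 0) := by
        rw [Finset.inter_comm, ← Finset.filter_mem_eq_inter, Finset.card_filter,
          Finset.sum_insert (by simp [hxy, hxz]), Finset.sum_insert (by simp [hyz]),
          Finset.sum_singleton, add_assoc]
      rwa [hc]

/-- The diagram of a simple graph is monotone in the two-point function, up to a power of the
constant. -/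
theorem IsSimple.Diag_le_diagSum {d : ℕ} (hG : G.IsSimple) {S : Finset V} (hS : S ⊆ G.verts)
    {τ : Vtx d → ℝ} {w : Sym2 (Vtx d) → ℝ≥0∞} {B : ℝ≥0∞}
    (hw : ∀ e, ENNReal.ofReal (tauSym τ e) ≤ B * w e) (ℓ : V → Vtx d) :
    G.Diag τ S ℓ ≤ B ^ G.numEdges *
      diagSum w (G.verts \ S) G.edgeFinset.val fun v => if v ∈ G.verts then ℓ v else 0 := by
  have hiff : ∀ f : V → Vtx d,
      ((∀ v ∈ (S : Set V), f v = ℓ v) ∧ ∀ v, v ∉ G.verts → f v = 0) ↔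
        ∀ v, v ∉ G.verts \ S → f v = if v ∈ G.verts then ℓ v else 0 := by
    intro f
    constructor
    · rintro ⟨h1, h2⟩ v hv
      by_cases hvG : v ∈ G.verts
      · rw [if_pos hvG]
        exact h1 v (by_contra fun hvS => hv (Finset.mem_sdiff.2 ⟨hvG, hvS⟩))
      · rw [if_neg hvG, h2 v hvG]
    · intro h
      refine ⟨fun v hv => ?_, fun v hv => ?_⟩
      · rw [h v fun hm => (Finset.mem_sdiff.1 hm).2 hv, if_pos (hS hv)]
      · rw [h v fun hm => hv (Finset.mem_sdiff.1 hm).1, if_neg hv]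
  rw [Diag, diagSum, ← ENNReal.tsum_mul_left, ← (Equiv.subtypeEquivRight hiff).tsum_eq]
  refine ENNReal.tsum_le_tsum fun f => ?_
  calc ∏ e ∈ G.verts.sym2, ENNReal.ofReal (tauSym τ (e.map f.1)) ^ G.mult e
      = ∏ e ∈ G.edgeFinset, ENNReal.ofReal (tauSym τ (e.map f.1)) := by
        rw [edgeFinset, Finset.prod_filter]
        refine Finset.prod_congr rfl fun e _ => ?_
        have := hG.1 e
        by_cases he : G.mult e = 0
        · simp [he]
        · rw [if_pos he, show G.mult e = 1 by omega, pow_one]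
    _ ≤ ∏ e ∈ G.edgeFinset, B * w (e.map f.1) := Finset.prod_le_prod' fun e _ => hw _
    _ = _ := by
        rw [Finset.prod_mul_distrib, Finset.prod_const, hG.card_edgeFinset]
        rfl

end Multigraph

end FromMultigraph

/-- **Triangle bound for diagrams of 3-connected graphs** (Proposition 4.17).
For `d > 6` and a two-point function `τ` with the standard two-sided power-law
bounds, there are constants `C_n` depending only on `d, c, C₀` and the edge number
`n` such that: whenever `G` is a finite connected simple graph, 3-connected to its
three distinct degree-2 vertices `x, y, z` with all other degrees 3, and the labels
are `ℓ(x) = 0`, `ℓ(y) = u`, `ℓ(z) = u'`, the diagram of `(G, {x,y,z}, ℓ)` is at most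
`C_{|E(G)|} · τ(0,u) τ(u,u') τ(u',0)`. -/
theorem triangle_bound_for_diagrams
    (d : ℕ) (hd : 6 < d) (c C₀ : ℝ) (hc : 0 < c) (hcC : c ≤ C₀) :
    ∃ C : ℕ → ℝ≥0∞, (∀ n, C n ≠ ⊤) ∧
      ∀ τ : Vtx d → ℝ,
        (∀ w, 0 ≤ τ w ∧ τ w ≤ 1) →
        τ 0 = 1 →
        (∀ w, τ (-w) = τ w) →
        (∀ w : Vtx d, w ≠ 0 →
          c * (1 + znorm w) ^ (2 - (d : ℝ)) ≤ τ w ∧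
          τ w ≤ C₀ * (1 + znorm w) ^ (2 - (d : ℝ))) →
        ∀ (V : Type) (G : Multigraph V) (x y z : V),
          x ≠ y → x ≠ z → y ≠ z →
          x ∈ G.verts → y ∈ G.verts → z ∈ G.verts →
          G.IsSimple → G.Connected →
          G.ThreeConnTo x y z →
          (∀ v ∈ G.verts, v ≠ x → v ≠ y → v ≠ z → G.deg v = 3) →
          G.deg x = 2 → G.deg y = 2 → G.deg z = 2 →
          ∀ (u u' : Vtx d) (ℓ : V → Vtx d),
            ℓ x = 0 → ℓ y = u → ℓ z = u' →
            Multigraph.Diag τ G {x, y, z} ℓ ≤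
              C G.numEdges *
                (ENNReal.ofReal (τ u) * ENNReal.ofReal (τ (u' - u)) *
                  ENNReal.ofReal (τ u')) := by
  set K : ℝ≥0∞ := ENNReal.ofReal (2 ^ (((d : ℝ) - 2) / 2))
  set T : ℝ≥0∞ := ∑' w : Vtx d, ENNReal.ofReal (sqrtDecay d w) ^ 3
  have hT' : T ≠ ⊤ := tsum_sqrtDecay_cube_ne_top hd
  have hkernel : PairKernel (pairDecay d) K T := pairKernel_pairDecay hd
  set B : ℝ≥0∞ := ENNReal.ofReal (max C₀ 1)
  set b : ℝ≥0∞ := ENNReal.ofReal (max c⁻¹ 1)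
  refine ⟨fun n => B ^ n * ((K ^ 4 * (288 * T ^ 2) + (K ^ 3 * (48 * T)) ^ 2 + 1) ^ n * b ^ 3),
    fun n => ?_, ?_⟩
  · have : K ≠ ⊤ := ENNReal.ofReal_ne_top
    have : B ≠ ⊤ := ENNReal.ofReal_ne_top
    have : b ≠ ⊤ := ENNReal.ofReal_ne_top
    finiteness
  intro τ hτ hτ0 hτneg hτb V G x y z hxy hxz hyz hx hy hz hG _ hconn hdeg hdx hdy hdz u u' ℓ
    hℓx hℓy hℓz
  have hs0 : sqrtDecay d 0 = 1 := by simp [sqrtDecay, znorm_zero]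
  have hupper : ∀ v, τ v ≤ max C₀ 1 * sqrtDecay d v ^ 2 := by
    intro v
    by_cases hv : v = 0
    · rw [hv, hτ0, hs0]; simp
    · refine (hτb v hv).2.trans ?_
      rw [sqrtDecay_sq]
      have := Real.rpow_nonneg (by linarith [znorm_nonneg v] : 0 ≤ 1 + znorm v) (2 - (d : ℝ))
      gcongr
      exact le_max_left _ _
  have hlower : ∀ v, sqrtDecay d v ^ 2 ≤ max c⁻¹ 1 * τ v := by
    intro v
    by_cases hv : v = 0
    · rw [hv, hτ0, hs0]; simp
    · calc sqrtDecay d v ^ 2 = c⁻¹ * (c * (1 + znorm v) ^ (2 - (d : ℝ))) := by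
            rw [sqrtDecay_sq, inv_mul_cancel_left₀ hc.ne']
        _ ≤ c⁻¹ * τ v := by gcongr; exact (hτb v hv).1
        _ ≤ max c⁻¹ 1 * τ v := by
            have := (hτ v).1
            gcongr
            exact le_max_left _ _
  set w : Sym2 (Vtx d) → ℝ≥0∞ :=
    Sym2.lift ⟨fun p q => pairDecay d p q ^ 2,
      fun p q => congrArg (· ^ 2) (hkernel.symm p q)⟩
  have hwτ : ∀ e, ENNReal.ofReal (tauSym τ e) ≤ B * w e := by
    intro e
    induction e using Sym2.ind with
    | _ p q =>
      have h1 : tauSym τ s(p, q) = τ (q - p) := by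
        simp only [tauSym, Sym2.lift_mk]
        rw [← neg_sub q p, hτneg]; ring
      rw [h1]
      change _ ≤ B * pairDecay d p q ^ 2
      rw [pairDecay, ← ENNReal.ofReal_pow (sqrtDecay_nonneg _),
        ← ENNReal.ofReal_mul (le_max_of_le_right zero_le_one)]
      exact ENNReal.ofReal_le_ofReal (hupper _)
  have hpair : ∀ p q, pairDecay d p q ^ 2 ≤ b * ENNReal.ofReal (τ (q - p)) := by
    intro p q
    rw [pairDecay, ← ENNReal.ofReal_pow (sqrtDecay_nonneg _),
      ← ENNReal.ofReal_mul (le_max_of_le_right zero_le_one)]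
    exact ENNReal.ofReal_le_ofReal (hlower _)
  have hcubic := Multigraph.rootedCubic hxy hxz hyz hx hy hz hG hconn hdeg hdx hdy hdz
  have hS : ({x, y, z} : Finset V) ⊆ G.verts :=
    Finset.insert_subset hx (Finset.insert_subset hy (Finset.singleton_subset_iff.2 hz))
  have h1 := hG.Diag_le_diagSum hS hwτ ℓ
  have h2 := hcubic.diagSum_le (w := w) hkernel (fun _ _ => rfl)
    fun v => if v ∈ G.verts then ℓ v else 0
  rw [Finset.card_val, hG.card_edgeFinset] at h2
  simp only [hx, hy, hz, if_true, hℓx, hℓy, hℓz] at h2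
  rw [Finset.coe_insert, Finset.coe_insert, Finset.coe_singleton] at h1
  refine h1.trans ?_
  calc _ ≤ B ^ G.numEdges * ((K ^ 4 * (288 * T ^ 2) + (K ^ 3 * (48 * T)) ^ 2 + 1) ^ G.numEdges *
        (pairDecay d 0 u * pairDecay d 0 u' * pairDecay d u u') ^ 2) := by gcongr
    _ = B ^ G.numEdges * ((K ^ 4 * (288 * T ^ 2) + (K ^ 3 * (48 * T)) ^ 2 + 1) ^ G.numEdges *
        (pairDecay d 0 u ^ 2 * pairDecay d 0 u' ^ 2 * pairDecay d u u' ^ 2)) := by ring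
    _ ≤ B ^ G.numEdges * ((K ^ 4 * (288 * T ^ 2) + (K ^ 3 * (48 * T)) ^ 2 + 1) ^ G.numEdges *
        ((b * ENNReal.ofReal (τ (u - 0))) * (b * ENNReal.ofReal (τ (u' - 0))) *
          (b * ENNReal.ofReal (τ (u' - u))))) := by
        gcongr <;> exact hpair _ _
    _ = _ := by rw [sub_zero, sub_zero]; ring
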